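/- arXiv:2006.16602 — 2 statements merged into one kernel-verified Lean document; each statement's English description precedes it below -/
import Mathlib

section
/- Let M be a metric space and f : M → M a homeomorphism. Let (K₁, j₁, h₁) and (K₂, j₂, h₂) be two weak Denjoy sub-systems for f with j₁(K₁) = j₂(K₂). Then there exists a homeomorphism g : 𝕋 → 𝕋 such that g ∘ h₁ = h₂ ∘ g. -/
open Filter Topology Set

noncomputable section

/-- A Denjoy example: an orientation-preserving circle homeomorphism with
irrational rotation number together with its minimal invariant Cantor set. -/
structure DenjoySystem where
  /-- the circle homeomorphism -/
  h : UnitAddCircle ≃ₜ UnitAddCircle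
  /-- the minimal set -/
  K : Set UnitAddCircle
  /-- a lift of `h` to `ℝ` -/
  lift : ℝ → ℝ
  lift_mono : StrictMono lift
  lift_cont : Continuous lift
  lift_bij : Function.Bijective lift
  lift_add : ∀ x : ℝ, lift (x + 1) = lift x + 1
  lift_proj : ∀ x : ℝ, ((lift x : ℝ) : UnitAddCircle) = h (x : UnitAddCircle)
  /-- a representative of the rotation number -/
  rot : ℝ
  rot_lim : Filter.Tendsto (fun n : ℕ => lift^[n] 0 / (n : ℝ)) Filter.atTop (nhds rot)
  rot_irr : Irrational rot
  K_ne : K.Nonempty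
  K_cpt : IsCompact K
  K_proper : K ≠ Set.univ
  K_inv : h '' K = K
  K_perf : Perfect K
  K_td : IsTotallyDisconnected K
  K_min : ∀ x ∈ K, ∀ y ∈ K, y ∈ closure {z | ∃ n : ℤ, (h.toEquiv ^ n) x = z}

/-- A weak Denjoy sub-system (WDS) for a map `f : M → M`. -/
structure WDS (M : Type*) [TopologicalSpace M] (f : M → M) extends DenjoySystem where
  /-- the embedding of the minimal set into `M` -/
  j : K → M
  j_emb : Topology.IsEmbedding j
  range_inv : f '' Set.range j = Set.range j
  equivar : ∀ x y : K, h (x : UnitAddCircle) = (y : UnitAddCircle) → j y = f (j x)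

/-- Weak cyclic order on the circle. -/
def CircBtw (a b c : UnitAddCircle) : Prop :=
  ∃ x y z : ℝ, (x : UnitAddCircle) = a ∧ (y : UnitAddCircle) = b ∧ (z : UnitAddCircle) = c ∧
    x ≤ y ∧ y ≤ z ∧ z ≤ x + 1

/-- The order graph of a WDS. -/
def WDS.orderGraph {M : Type*} [TopologicalSpace M] {f : M → M} (W : WDS M f) :
    Set (M × M × M) :=
  {p | ∃ a b c : W.K, CircBtw (a : UnitAddCircle) (b : UnitAddCircle) (c : UnitAddCircle) ∧ p = (W.j a, W.j b, W.j c)}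

/-- The reverse of the order graph of a WDS. -/
def WDS.revGraph {M : Type*} [TopologicalSpace M] {f : M → M} (W : WDS M f) :
    Set (M × M × M) :=
  {p | (p.2.2, p.2.1, p.1) ∈ W.orderGraph}


structure SemiLift (H : ℝ ≃o ℝ) (P : ℝ → ℝ) (ρ : ℝ) : Prop where
  cont : Continuous P
  mono : Monotone P
  add_one : ∀ x, P (x + 1) = P x + 1
  semi : ∀ x, P (H x) = P x + ρ

namespace SemiLift

variable {H : ℝ ≃o ℝ} {P : ℝ → ℝ} {ρ : ℝ}

lemma add_int (S : SemiLift H P ρ) (x : ℝ) (n : ℤ) : P (x + n) = P x + n := by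
  induction n using Int.induction_on with
  | zero => simp
  | succ i ih =>
    have := S.add_one (x + (i : ℤ))
    push_cast at *
    rw [← add_assoc, this, ih]; ring
  | pred i ih =>
    have := S.add_one (x + (-(i : ℤ) - 1 : ℤ))
    push_cast at *
    rw [show x + (-(i : ℝ) - 1) + 1 = x + -i by ring, ih] at this
    linarith

lemma zpow (S : SemiLift H P ρ) (x : ℝ) (n : ℤ) : P ((H ^ n) x) = P x + n * ρ := by
  induction n using Int.induction_on generalizing x with
  | zero => simp
  | succ i ih =>
    rw [zpow_add_one, RelIso.mul_apply, ih, S.semi]; push_cast; ring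
  | pred i ih =>
    rw [zpow_sub_one, RelIso.mul_apply, ih]
    have := S.semi (H⁻¹ x)
    rw [RelIso.apply_inv_self] at this
    push_cast; linarith

lemma surj (S : SemiLift H P ρ) : Function.Surjective P := by
  intro t
  have h1 : P (⌊t - P 0⌋ : ℝ) = P 0 + ⌊t - P 0⌋ := by simpa using S.add_int 0 ⌊t - P 0⌋
  have h2 := S.add_one (⌊t - P 0⌋ : ℝ)
  have h3 := Int.floor_le (t - P 0)
  have h4 := Int.lt_floor_add_one (t - P 0)
  obtain ⟨x, -, hx⟩ := intermediate_value_Icc (f := P) (a := (⌊t - P 0⌋ : ℝ))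
    (b := ⌊t - P 0⌋ + 1) (by linarith) S.cont.continuousOn
    (show t ∈ _ from ⟨by linarith, by linarith⟩)
  exact ⟨x, hx⟩

lemma fibre (S : SemiLift H P ρ) (t : ℝ) : ∃ a b, a ≤ b ∧ ∀ x, P x = t ↔ a ≤ x ∧ x ≤ b := by
  obtain ⟨x0, h0⟩ := S.surj t
  have hc : IsCompact {x | P x = t} := by
    refine (isCompact_Icc (a := x0 - 1) (b := x0 + 1)).of_isClosed_subset
      (isClosed_eq S.cont continuous_const) ?_
    intro x hx
    have hx : P x = t := hx
    constructor
    · by_contra hlt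
      have h1 := S.mono (show x + 1 ≤ x0 by linarith)
      rw [S.add_one] at h1; linarith
    · by_contra hlt
      have h1 := S.mono (show x0 + 1 ≤ x by linarith)
      rw [S.add_one] at h1; linarith
  obtain ⟨a, ha, ha'⟩ := hc.exists_isLeast ⟨x0, h0⟩
  obtain ⟨b, hb, hb'⟩ := hc.exists_isGreatest ⟨x0, h0⟩
  have ha : P a = t := ha
  have hb : P b = t := hb
  refine ⟨a, b, ha' hb, fun x => ⟨fun hx => ⟨ha' hx, hb' hx⟩, fun hx => ?_⟩⟩
  have h1 := S.mono hx.1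
  have h2 := S.mono hx.2
  linarith

end SemiLift

/-- nontrivial fibre -/
def NT (P : ℝ → ℝ) (t : ℝ) : Prop := ∃ x y, x < y ∧ P x = t ∧ P y = t

lemma exists_fibre_iso {H₁ H₂ : ℝ ≃o ℝ} {P₁ P₂ : ℝ → ℝ} {ρ₁ ρ₂ : ℝ} (S₁ : SemiLift H₁ P₁ ρ₁)
    (S₂ : SemiLift H₂ P₂ ρ₂) (hNT : ∀ t, NT P₁ t ↔ NT P₂ t) (t : ℝ) :
    ∃ e : ℝ ≃o ℝ, ∀ x, P₁ x = t ↔ P₂ (e x) = t := by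
  obtain ⟨a₁, b₁, h₁, f₁⟩ := S₁.fibre t
  obtain ⟨a₂, b₂, h₂, f₂⟩ := S₂.fibre t
  have n₁ : NT P₁ t ↔ a₁ < b₁ :=
    ⟨fun ⟨x, y, hxy, hx, hy⟩ => by
      have := ((f₁ x).1 hx).1; have := ((f₁ y).1 hy).2; linarith,
     fun h => ⟨a₁, b₁, h, (f₁ _).2 ⟨le_rfl, h.le⟩, (f₁ _).2 ⟨h.le, le_rfl⟩⟩⟩
  have n₂ : NT P₂ t ↔ a₂ < b₂ :=
    ⟨fun ⟨x, y, hxy, hx, hy⟩ => by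
      have := ((f₂ x).1 hx).1; have := ((f₂ y).1 hy).2; linarith,
     fun h => ⟨a₂, b₂, h, (f₂ _).2 ⟨le_rfl, h.le⟩, (f₂ _).2 ⟨h.le, le_rfl⟩⟩⟩
  have key : a₁ < b₁ ↔ a₂ < b₂ := by rw [← n₁, ← n₂, hNT]
  obtain ⟨k, hk, hk'⟩ : ∃ k : ℝ, 0 < k ∧ b₂ - a₂ = (b₁ - a₁) * k := by
    rcases h₁.lt_or_eq with h | h
    · have h' := key.1 h
      refine ⟨(b₂ - a₂) / (b₁ - a₁), div_pos (by linarith) (by linarith), ?_⟩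
      have : b₁ - a₁ ≠ 0 := by linarith
      field_simp
    · have : ¬ a₂ < b₂ := fun h' => by have := key.2 h'; linarith
      exact ⟨1, one_pos, by linarith⟩
  let e : ℝ ≃o ℝ := ((OrderIso.subRight a₁).trans (OrderIso.mulRight₀ k hk)).trans
    (OrderIso.addRight a₂)
  have he : ∀ x, e x = (x - a₁) * k + a₂ := fun x => rfl
  refine ⟨e, fun x => ?_⟩
  rw [f₁, f₂, he, show b₂ = (b₁ - a₁) * k + a₂ by linarith]
  constructor
  · rintro ⟨u, v⟩
    exact ⟨by nlinarith, by nlinarith⟩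
  · rintro ⟨u, v⟩
    constructor
    · by_contra hh; nlinarith
    · by_contra hh; nlinarith

lemma irr_unique {ρ : ℝ} (hρ : Irrational ρ) {m n m' n' : ℤ}
    (h : (m : ℝ) * ρ + n = m' * ρ + n') : m = m' ∧ n = n' := by
  have hm : m = m' := by
    by_contra hne
    have hne' : ((m - m' : ℤ) : ℝ) ≠ 0 := by exact_mod_cast sub_ne_zero.2 hne
    apply hρ
    refine ⟨(n' - n : ℤ) / (m - m' : ℤ), ?_⟩
    push_cast at *
    field_simp
    linarith
  subst hm
  refine ⟨rfl, ?_⟩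
  have : (n : ℝ) = n' := by linarith
  exact_mod_cast this

lemma exists_coords {ρ : ℝ} (hρ : Irrational ρ) : ∃ (r : ℝ → ℝ) (m n : ℝ → ℤ),
    (∀ t, t = r t + (m t * ρ + n t)) ∧
    (∀ t, r (t + ρ) = r t ∧ m (t + ρ) = m t + 1 ∧ n (t + ρ) = n t) ∧
    (∀ t, r (t + 1) = r t ∧ m (t + 1) = m t ∧ n (t + 1) = n t + 1) := by
  let s : Setoid ℝ :=
    { r := fun t u => ∃ m n : ℤ, t = u + (m * ρ + n)
      iseqv := ⟨fun t => ⟨0, 0, by simp⟩,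
        fun {t u} ⟨m, n, h⟩ => ⟨-m, -n, by rw [h]; push_cast; ring⟩,
        fun {t u v} ⟨m, n, h⟩ ⟨m', n', h'⟩ => ⟨m + m', n + n', by rw [h, h']; push_cast; ring⟩⟩ }
  have hs : ∀ t u : ℝ, s.r t u ↔ ∃ m n : ℤ, t = u + (m * ρ + n) := fun _ _ => Iff.rfl
  let r : ℝ → ℝ := fun t => (Quotient.mk s t).out
  have hr : ∀ t, ∃ m n : ℤ, t = r t + (m * ρ + n) := fun t =>
    (hs _ _).1 (s.symm (Quotient.mk_out (s := s) t))
  choose m n hmn using hr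
  have r1 : ∀ t, r (t + ρ) = r t := fun t => by
    have : Quotient.mk s (t + ρ) = Quotient.mk s t :=
      Quotient.sound ((hs _ _).2 ⟨1, 0, by simp⟩)
    simp only [r, this]
  have r2 : ∀ t, r (t + 1) = r t := fun t => by
    have : Quotient.mk s (t + 1) = Quotient.mk s t :=
      Quotient.sound ((hs _ _).2 ⟨0, 1, by simp⟩)
    simp only [r, this]
  refine ⟨r, m, n, hmn, fun t => ⟨r1 t, ?_⟩, fun t => ⟨r2 t, ?_⟩⟩
  · have h1 := hmn (t + ρ)
    have h2 := hmn t
    rw [r1] at h1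
    apply irr_unique hρ
    push_cast
    linarith
  · have h1 := hmn (t + 1)
    have h2 := hmn t
    rw [r2] at h1
    apply irr_unique hρ
    push_cast
    linarith

theorem exists_conj_lift {H₁ H₂ : ℝ ≃o ℝ} {P₁ P₂ : ℝ → ℝ} {ρ : ℝ} (hρ : Irrational ρ)
    (S₁ : SemiLift H₁ P₁ ρ) (S₂ : SemiLift H₂ P₂ ρ)
    (c₁ : ∀ x, H₁ (x + 1) = H₁ x + 1) (c₂ : ∀ x, H₂ (x + 1) = H₂ x + 1)
    (hNT : ∀ t, NT P₁ t ↔ NT P₂ t) :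
    ∃ G : ℝ ≃o ℝ, (∀ x, G (x + 1) = G x + 1) ∧ ∀ x, G (H₁ x) = H₂ (G x) := by
  choose e he using exists_fibre_iso S₁ S₂ hNT
  obtain ⟨r, m, n, h0, hrρ, hr1⟩ := exists_coords hρ
  let T : ℝ ≃o ℝ := OrderIso.addRight 1
  have hT : ∀ x, T x = x + 1 := fun x => rfl
  have C₁ : Commute H₁ T := by
    apply RelIso.ext; intro x; simp only [RelIso.mul_apply, hT, c₁]
  have C₂ : Commute H₂ T := by
    apply RelIso.ext; intro x; simp only [RelIso.mul_apply, hT, c₂]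
  have T₁ : SemiLift T P₁ 1 := ⟨S₁.cont, S₁.mono, S₁.add_one, S₁.add_one⟩
  have T₂ : SemiLift T P₂ 1 := ⟨S₂.cont, S₂.mono, S₂.add_one, S₂.add_one⟩
  let c : ℝ → (ℝ ≃o ℝ) := fun t =>
    (H₂ ^ m t * T ^ n t) * e (r t) * (H₁ ^ m t * T ^ n t)⁻¹
  have cρ : ∀ t, c (t + ρ) * H₁ = H₂ * c t := by
    intro t
    simp only [c, (hrρ t).1, (hrρ t).2.1, (hrρ t).2.2]
    rw [zpow_add, zpow_add, zpow_one, zpow_one, (Commute.refl H₂).zpow_left _ |>.eq,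
      (Commute.refl H₁).zpow_left _ |>.eq]
    group
  have c1 : ∀ t, c (t + 1) * T = T * c t := by
    intro t
    simp only [c, (hr1 t).1, (hr1 t).2.1, (hr1 t).2.2]
    have e1 : H₁ ^ m t * T ^ (n t + 1) = T * (H₁ ^ m t * T ^ n t) := by
      rw [zpow_add_one, ← mul_assoc]
      exact ((C₁.zpow_left (m t)).mul_left ((Commute.refl T).zpow_left (n t))).eq
    have e2 : H₂ ^ m t * T ^ (n t + 1) = T * (H₂ ^ m t * T ^ n t) := by
      rw [zpow_add_one, ← mul_assoc]
      exact ((C₂.zpow_left (m t)).mul_left ((Commute.refl T).zpow_left (n t))).eq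
    rw [e1, e2]
    group
  have cf : ∀ t x, P₁ x = t ↔ P₂ (c t x) = t := by
    intro t x
    obtain ⟨y, rfl⟩ := (H₁ ^ m t * T ^ n t).surjective x
    have : c t ((H₁ ^ m t * T ^ n t) y) = (H₂ ^ m t * T ^ n t) (e (r t) y) := by
      simp only [c, RelIso.mul_apply _ _ ((H₁ ^ m t * T ^ n t) y), RelIso.inv_apply_self]
      rw [RelIso.mul_apply]
    rw [this, RelIso.mul_apply, RelIso.mul_apply, S₁.zpow, S₂.zpow, T₁.zpow, T₂.zpow]
    have h1 := h0 t
    have h2 := he (r t) y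
    constructor
    · intro h
      have := h2.1 (by linarith)
      linarith
    · intro h
      have := h2.2 (by linarith)
      linarith
  let G : ℝ → ℝ := fun x => c (P₁ x) x
  have hPG : ∀ x, P₂ (G x) = P₁ x := fun x => (cf _ _).1 rfl
  have hmono : StrictMono G := by
    intro x y hxy
    rcases (S₁.mono hxy.le).lt_or_eq with h | h
    · by_contra hh
      have := S₂.mono (not_lt.1 hh)
      rw [hPG, hPG] at this
      linarith
    · simp only [G, h]
      exact (c _).strictMono hxy
  have hsurj : Function.Surjective G := by
    intro y
    obtain ⟨x, hx⟩ := (c (P₂ y)).surjective y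
    have h1 : P₁ x = P₂ y := (cf _ _).2 (by rw [hx])
    exact ⟨x, by simp only [G, h1, hx]⟩
  refine ⟨hmono.orderIsoOfSurjective G hsurj, fun x => ?_, fun x => ?_⟩
  · have := congrArg (fun u : ℝ ≃o ℝ => u x) (c1 (P₁ x))
    simp only [RelIso.mul_apply, hT] at this
    simp only [StrictMono.coe_orderIsoOfSurjective, G, S₁.add_one, this]
  · have := congrArg (fun u : ℝ ≃o ℝ => u x) (cρ (P₁ x))
    simp only [RelIso.mul_apply] at this
    simp only [StrictMono.coe_orderIsoOfSurjective, G, S₁.semi, this]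
lemma coe_eq_iff (x y : ℝ) : (x : UnitAddCircle) = y ↔ ∃ k : ℤ, x = y + k := by
  constructor
  · intro h
    have h1 : ((x - y : ℝ) : UnitAddCircle) = 0 := by rw [AddCircle.coe_sub, h, sub_self]
    obtain ⟨k, hk⟩ := (AddCircle.coe_eq_zero_iff (1 : ℝ)).1 h1
    refine ⟨k, ?_⟩
    simp at hk
    linarith
  · rintro ⟨k, rfl⟩
    have : ((k : ℝ) : UnitAddCircle) = 0 := (AddCircle.coe_eq_zero_iff (1 : ℝ)).2 ⟨k, by simp⟩
    rw [AddCircle.coe_add, this, add_zero]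

lemma exists_coe (x : UnitAddCircle) : ∃ y : ℝ, (y : UnitAddCircle) = x :=
  QuotientAddGroup.mk_surjective x

lemma exists_circle_map {F : ℝ → ℝ} (hF : Continuous F) (h1 : ∀ x, F (x + 1) = F x + 1) :
    ∃ p : UnitAddCircle → UnitAddCircle, Continuous p ∧
      ∀ x : ℝ, p (x : UnitAddCircle) = (F x : UnitAddCircle) := by
  have hper : Function.Periodic (fun x : ℝ => (F x : UnitAddCircle)) 1 := by
    intro x
    simp only [h1]
    exact (coe_eq_iff _ _).2 ⟨1, by simp⟩
  refine ⟨hper.lift, ?_, fun x => rfl⟩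
  have hc : Continuous (fun x : ℝ => (F x : UnitAddCircle)) :=
    (AddCircle.continuous_mk' (1 : ℝ)).comp hF
  exact continuous_quot_lift _ hc

lemma exists_circle_homeo (G : ℝ ≃o ℝ) (h1 : ∀ x, G (x + 1) = G x + 1) :
    ∃ g : UnitAddCircle ≃ₜ UnitAddCircle,
      ∀ x : ℝ, g (x : UnitAddCircle) = (G x : UnitAddCircle) := by
  have h2 : ∀ x, G.symm (x + 1) = G.symm x + 1 := by
    intro x
    apply G.injective
    rw [h1]; simp
  obtain ⟨g, gc, hg⟩ := exists_circle_map G.continuous h1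
  obtain ⟨k, kc, hk⟩ := exists_circle_map G.symm.continuous h2
  refine ⟨⟨⟨g, k, ?_, ?_⟩, gc, kc⟩, hg⟩
  · intro x
    obtain ⟨y, rfl⟩ := exists_coe x
    rw [hg, hk]; simp
  · intro x
    obtain ⟨y, rfl⟩ := exists_coe x
    rw [hk, hg]; simp

open MeasureTheory in
lemma continuous_hom_eq_zsmul (q : UnitAddCircle → UnitAddCircle) (hq : Continuous q)
    (hadd : ∀ x y, q (x + y) = q x + q y) : ∃ n : ℤ, ∀ x, q x = n • x := by
  have hq0 : q 0 = 0 := by simpa using hadd 0 0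
  let f : C(UnitAddCircle, ℂ) :=
    ⟨fun x => (AddCircle.toCircle (q x) : ℂ), by
      exact continuous_subtype_val.comp (AddCircle.continuous_toCircle.comp hq)⟩
  have hf : ∀ x, f x = (AddCircle.toCircle (q x) : ℂ) := fun _ => rfl
  by_cases hz : ∀ n, fourierCoeff f n = 0
  · exfalso
    have hs : Summable (fourierCoeff f) := by
      rw [show fourierCoeff f = fun _ => 0 from funext hz]; exact summable_zero
    have h1 := has_pointwise_sum_fourier_series_of_summable hs 0
    simp only [hz, zero_smul] at h1
    have := h1.unique hasSum_zero
    rw [hf, hq0] at this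
    simp at this
  · push Not at hz
    obtain ⟨n, hn⟩ := hz
    refine ⟨n, fun a => ?_⟩
    have hinv : ∫ t : UnitAddCircle, fourier (-n) (t + a) • f (t + a) ∂AddCircle.haarAddCircle
        = fourierCoeff f n :=
      integral_add_right_eq_self (μ := AddCircle.haarAddCircle)
        (fun t : UnitAddCircle => fourier (-n) t • f t) a
    have hmul : ∀ t : UnitAddCircle, fourier (-n) (t + a) • f (t + a)
        = (fourier (-n) a * f a) * (fourier (-n) t • f t) := by
      intro t
      simp only [hf, hadd, AddCircle.toCircle_add, fourier_apply, smul_add, Circle.coe_mul,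
        smul_eq_mul]
      ring
    simp only [hmul] at hinv
    rw [integral_const_mul] at hinv
    have h1 : fourier (-n) a * f a = 1 := by
      have : (fourier (-n) a * f a - 1) * fourierCoeff f n = 0 := by
        rw [sub_mul, one_mul, sub_eq_zero]; exact hinv
      rcases mul_eq_zero.1 this with h | h
      · exact sub_eq_zero.1 h
      · exact absurd h hn
    have h2 : fourier n a * fourier (-n) a = 1 := by
      rw [← fourier_add]; simp
    have h3 : fourier n a = f a := by
      calc fourier n a = fourier n a * (fourier (-n) a * f a) := by rw [h1, mul_one]
        _ = f a := by rw [← mul_assoc, h2, one_mul]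
    rw [hf, fourier_apply] at h3
    exact (AddCircle.injective_toCircle (one_ne_zero) (Subtype.ext h3)).symm

lemma injective_hom_sign (q : UnitAddCircle → UnitAddCircle) (hq : Continuous q)
    (hadd : ∀ x y, q (x + y) = q x + q y) (hinj : Function.Injective q) :
    (∀ x, q x = x) ∨ (∀ x, q x = -x) := by
  obtain ⟨n, hn⟩ := continuous_hom_eq_zsmul q hq hadd
  have key : ∀ r : ℝ, (∃ k : ℤ, n * r = k) → ∃ k : ℤ, r = k := by
    rintro r ⟨k, hk⟩
    have h1 : q (r : UnitAddCircle) = q ((0 : ℝ) : UnitAddCircle) := by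
      rw [hn, hn, ← AddCircle.coe_zsmul, ← AddCircle.coe_zsmul]
      refine (coe_eq_iff _ _).2 ⟨k, by simp [hk]⟩
    obtain ⟨k', hk'⟩ := (coe_eq_iff _ _).1 (hinj h1)
    exact ⟨k', by simpa using hk'⟩
  have hn0 : n ≠ 0 := by
    rintro rfl
    obtain ⟨k, hk⟩ := key (1 / 2) ⟨0, by simp⟩
    have : (1 : ℝ) = ((2 * k : ℤ) : ℝ) := by push_cast; linarith
    have : (1 : ℤ) = 2 * k := by exact_mod_cast this
    omega
  have hn0' : (n : ℝ) ≠ 0 := by exact_mod_cast hn0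
  obtain ⟨k, hk⟩ := key (1 / n) ⟨1, by field_simp; simp⟩
  have : (n : ℝ) * k = 1 := by rw [← hk]; field_simp
  have : n * k = 1 := by exact_mod_cast this
  rcases Int.eq_one_or_neg_one_of_mul_eq_one this with rfl | rfl
  · left; intro x; rw [hn]; simp
  · right; intro x; rw [hn]; simp

namespace DenjoySystem

def H (D : DenjoySystem) : ℝ ≃o ℝ := D.lift_mono.orderIsoOfSurjective _ D.lift_bij.2

lemma H_apply (D : DenjoySystem) (x : ℝ) : D.H x = D.lift x := rfl

lemma H_add_one (D : DenjoySystem) (x : ℝ) : D.H (x + 1) = D.H x + 1 := D.lift_add x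

lemma H_coe (D : DenjoySystem) (x : ℝ) : ((D.H x : ℝ) : UnitAddCircle) = D.h x := D.lift_proj x

lemma H_pow_coe (D : DenjoySystem) (x : ℝ) (n : ℕ) :
    (((D.H ^ n) x : ℝ) : UnitAddCircle) = D.h^[n] x := by
  induction n generalizing x with
  | zero => simp
  | succ n ih =>
    rw [pow_succ, RelIso.mul_apply, ih, Function.iterate_succ_apply, H_coe]

lemma exists_semiLift (D : DenjoySystem) : ∃ P, SemiLift D.H P D.rot := by
  let L : CircleDeg1Lift := ⟨⟨D.lift, D.lift_mono.monotone⟩, D.lift_add⟩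
  have hL : CircleDeg1Lift.translationNumber L = D.rot :=
    L.translationNumber_eq_of_tendsto₀ D.rot_lim
  obtain ⟨F, hF⟩ := CircleDeg1Lift.semiconj_of_bijective_of_translationNumber_eq
    (f₁ := L) (f₂ := (CircleDeg1Lift.translate (Multiplicative.ofAdd D.rot) : CircleDeg1Lift))
    D.lift_bij (CircleDeg1Lift.isUnit_iff_bijective.1 (Units.isUnit _))
    (by rw [hL, CircleDeg1Lift.translationNumber_translate])
  have hsemi : ∀ x, F (D.lift x) = F x + D.rot := fun x => by
    have := hF x
    rw [CircleDeg1Lift.translate_apply, add_comm] at this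
    exact this
  refine ⟨F, ?_, F.monotone, F.map_add_one, hsemi⟩
  apply F.monotone.continuous_of_denseRange
  have hd := dense_addSubgroupClosure_pair_iff (a := D.rot) (b := 1)
  rw [div_one] at hd
  have hd := hd.2 D.rot_irr
  have hd2 : Dense ((fun y => F 0 + y) '' (AddSubgroup.closure {D.rot, (1 : ℝ)} : Set ℝ)) :=
    (Homeomorph.addLeft (F 0)).surjective.denseRange.dense_image
      (Homeomorph.addLeft (F 0)).continuous hd
  refine hd2.mono ?_
  rintro _ ⟨y, hy, rfl⟩
  have hstep : ∀ z ∈ range F, z + D.rot ∈ range F ∧ z - D.rot ∈ range F ∧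
      z + 1 ∈ range F ∧ z - 1 ∈ range F := by
    rintro _ ⟨x, rfl⟩
    refine ⟨⟨D.lift x, hsemi x⟩, ?_, ⟨x + 1, F.map_add_one x⟩, ?_⟩
    · obtain ⟨x, rfl⟩ := D.lift_bij.2 x
      exact ⟨x, by rw [hsemi]; ring⟩
    · exact ⟨x - 1, by have := F.map_add_one (x - 1); rw [sub_add_cancel] at this; linarith⟩
  have hgen : ∀ z, z ∈ range F ↔ z + y ∈ range F := by
    induction hy using AddSubgroup.closure_induction with
    | mem y hy =>
      intro z
      rcases hy with rfl | rfl
      · exact ⟨fun h => (hstep z h).1, fun h => by simpa using (hstep _ h).2.1⟩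
      · exact ⟨fun h => (hstep z h).2.2.1, fun h => by simpa using (hstep _ h).2.2.2⟩
    | zero => simp
    | add a b _ _ ha hb => intro z; rw [ha, hb, add_assoc]
    | neg a _ ha => intro z; rw [ha (z + -a)]; simp
  exact (hgen _).1 ⟨0, rfl⟩

end DenjoySystem

/-- The semiconjugacy to a rotation, with its lift. -/
structure Fac (D : DenjoySystem) (P : ℝ → ℝ) (p : UnitAddCircle → UnitAddCircle) : Prop where
  S : SemiLift D.H P D.rot
  cont : Continuous p
  coe : ∀ x : ℝ, p x = (P x : UnitAddCircle)

lemma exists_fac (D : DenjoySystem) : ∃ P p, Fac D P p := by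
  obtain ⟨P, hP⟩ := D.exists_semiLift
  obtain ⟨p, hp, hp'⟩ := exists_circle_map hP.cont hP.add_one
  exact ⟨P, p, hP, hp, hp'⟩

/-- restriction of `h` to `K` -/
def DenjoySystem.hK (D : DenjoySystem) (x : D.K) : D.K :=
  ⟨D.h x, D.K_inv.subset ⟨x, x.2, rfl⟩⟩

lemma DenjoySystem.hK_iter (D : DenjoySystem) (x : D.K) (n : ℕ) :
    ((D.hK^[n] x : D.K) : UnitAddCircle) = D.h^[n] x := by
  induction n generalizing x with
  | zero => rfl
  | succ n ih => rw [Function.iterate_succ_apply, ih, Function.iterate_succ_apply]; rfl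

lemma DenjoySystem.hK_surj (D : DenjoySystem) : Function.Surjective D.hK := by
  rintro ⟨x, hx⟩
  rw [← D.K_inv] at hx
  obtain ⟨y, hy, rfl⟩ := hx
  exact ⟨⟨y, hy⟩, rfl⟩

namespace Fac

variable {D : DenjoySystem} {P : ℝ → ℝ} {p : UnitAddCircle → UnitAddCircle}

lemma semi (A : Fac D P p) (x : UnitAddCircle) : p (D.h x) = p x + (D.rot : UnitAddCircle) := by
  obtain ⟨y, rfl⟩ := exists_coe x
  rw [← D.H_coe, A.coe, A.coe, A.S.semi, AddCircle.coe_add]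

lemma surjK (A : Fac D P p) (s : UnitAddCircle) : ∃ x : D.K, p x = s := by
  obtain ⟨x0, hx0⟩ := D.K_ne
  have hcl : IsClosed (p '' D.K) := (D.K_cpt.image A.cont).isClosed
  have hd : DenseRange (fun n : ℤ => n • (D.rot : UnitAddCircle)) :=
    AddCircle.denseRange_zsmul_coe_iff.2 (by simpa using D.rot_irr)
  have hall : ∀ u : UnitAddCircle, p x0 + u ∈ p '' D.K := by
    intro u
    refine hd.induction_on (p := fun u => p x0 + u ∈ p '' D.K) u
      (hcl.preimage (continuous_const.add continuous_id)) ?_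
    intro n
    induction n using Int.induction_on with
    | zero => exact ⟨x0, hx0, by simp⟩
    | succ i ih =>
      obtain ⟨x, hx, hx'⟩ := ih
      refine ⟨D.h x, (D.hK ⟨x, hx⟩).2, ?_⟩
      rw [A.semi, hx', add_zsmul, one_zsmul, add_assoc]
    | pred i ih =>
      obtain ⟨x, hx, hx'⟩ := ih
      obtain ⟨y, hy⟩ := D.hK_surj ⟨x, hx⟩
      refine ⟨y, y.2, ?_⟩
      have h1 : D.h y = x := congrArg Subtype.val hy
      have h2 := A.semi y
      rw [h1, hx'] at h2
      rw [sub_zsmul, one_zsmul, ← sub_eq_add_neg, ← add_sub_assoc, h2, add_sub_cancel_right]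
  obtain ⟨x, hx, hx'⟩ := hall (s - p x0)
  exact ⟨⟨x, hx⟩, by simpa using hx'⟩

lemma lift_eq (A : Fac D P p) {x y : UnitAddCircle} (h : p x = p y) :
    ∃ X Y : ℝ, (X : UnitAddCircle) = x ∧ (Y : UnitAddCircle) = y ∧ P X = P Y := by
  obtain ⟨X, rfl⟩ := exists_coe x
  obtain ⟨Y, rfl⟩ := exists_coe y
  rw [A.coe, A.coe] at h
  obtain ⟨k, hk⟩ := (coe_eq_iff _ _).1 h
  exact ⟨X, Y + k, rfl, (coe_eq_iff _ _).2 ⟨k, rfl⟩, by rw [A.S.add_int, hk]⟩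

lemma prox_aux (A : Fac D P p) {X Y : ℝ} (hXY : X ≤ Y) (hP : P X = P Y) {ε : ℝ} (hε : 0 < ε) :
    ∃ n : ℕ, (D.H ^ n) Y - (D.H ^ n) X < ε := by
  obtain ⟨a, -, φ, hφ, hlim⟩ := isCompact_univ.tendsto_subseq
    (x := fun n : ℕ => (((D.H ^ n) X : ℝ) : UnitAddCircle)) (fun n => mem_univ _)
  obtain ⟨N, hN⟩ := Metric.cauchySeq_iff.1 hlim.cauchySeq ε hε
  have hd := hN N le_rfl (N + 1) (Nat.le_succ N)
  have hne : φ N ≠ φ (N + 1) := (hφ (Nat.lt_succ_self N)).ne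
  simp only [Function.comp] at hd
  generalize φ N = i at *
  generalize φ (N + 1) = j at *
  rw [dist_eq_norm, ← AddCircle.coe_sub, UnitAddCircle.norm_eq] at hd
  generalize round ((D.H ^ i) X - (D.H ^ j) X) = k at hd
  have hZ : ∀ (n : ℕ) x, P ((D.H ^ n) x) = P x + n * D.rot := fun n x => by
    simpa using A.S.zpow x n
  have hPne : P ((D.H ^ i) X) ≠ P ((D.H ^ j) X + k) := by
    intro h
    rw [A.S.add_int, hZ, hZ] at h
    have h' : ((i : ℤ) : ℝ) * D.rot + (0 : ℤ) = ((j : ℤ) : ℝ) * D.rot + k := by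
      push_cast; linarith
    have := (irr_unique D.rot_irr h').1
    exact hne (by exact_mod_cast this)
  have hiY : P ((D.H ^ i) Y) = P ((D.H ^ i) X) := by rw [hZ, hZ, hP]
  have hjY : P ((D.H ^ j) Y + k) = P ((D.H ^ j) X + k) := by
    rw [A.S.add_int, A.S.add_int, hZ, hZ, hP]
  rw [abs_lt] at hd
  rcases le_total ((D.H ^ j) X + k) ((D.H ^ i) X) with h | h
  · refine ⟨j, ?_⟩
    by_contra hh
    apply hPne
    have h1 := A.S.mono h
    have h2 := A.S.mono (show (D.H ^ i) X ≤ (D.H ^ j) Y + k by linarith)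
    linarith
  · refine ⟨i, ?_⟩
    by_contra hh
    apply hPne
    have h1 := A.S.mono h
    have h2 := A.S.mono (show (D.H ^ j) X + k ≤ (D.H ^ i) Y by linarith)
    linarith

lemma prox (A : Fac D P p) {x y : UnitAddCircle} (h : p x = p y) {ε : ℝ} (hε : 0 < ε) :
    ∃ n : ℕ, dist (D.h^[n] x) (D.h^[n] y) < ε := by
  obtain ⟨X, Y, rfl, rfl, hP⟩ := A.lift_eq h
  have hle : ∀ a b : ℝ, dist (a : UnitAddCircle) (b : UnitAddCircle) ≤ |a - b| := by
    intro a b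
    rw [dist_eq_norm, ← AddCircle.coe_sub, UnitAddCircle.norm_eq]
    simpa using round_le (a - b) 0
  simp only [← D.H_pow_coe]
  rcases le_total X Y with hXY | hXY
  · obtain ⟨n, hn⟩ := A.prox_aux hXY hP hε
    refine ⟨n, (hle _ _).trans_lt ?_⟩
    have := (D.H ^ n).monotone hXY
    rw [abs_lt]; constructor <;> linarith
  · obtain ⟨n, hn⟩ := A.prox_aux hXY hP.symm hε
    refine ⟨n, (hle _ _).trans_lt ?_⟩
    have := (D.H ^ n).monotone hXY
    rw [abs_lt]; constructor <;> linarith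

lemma NT_iff (A : Fac D P p) (t : ℝ) :
    NT P t ↔ ∃ x y : D.K, x ≠ y ∧ p x = (t : UnitAddCircle) ∧ p y = (t : UnitAddCircle) := by
  constructor
  · rintro ⟨u, v, huv, hu, hv⟩
    obtain ⟨a, b, hab, hf⟩ := A.S.fibre t
    have hab : a < b := by
      have := (hf u).1 hu; have := (hf v).1 hv; linarith
    have hPa : P a = t := (hf a).2 ⟨le_rfl, hab.le⟩
    have hPb : P b = t := (hf b).2 ⟨hab.le, le_rfl⟩
    have hcl : IsClosed {x : ℝ | (x : UnitAddCircle) ∈ D.K} :=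
      D.K_cpt.isClosed.preimage (AddCircle.continuous_mk' (1 : ℝ))
    have hsur : ∀ s : ℝ, ∃ x : ℝ, (x : UnitAddCircle) ∈ D.K ∧ P x = s := by
      intro s
      obtain ⟨x, hx⟩ := A.surjK s
      obtain ⟨X, hX⟩ := exists_coe x
      rw [← hX, A.coe] at hx
      obtain ⟨k, hk⟩ := (coe_eq_iff _ _).1 hx.symm
      refine ⟨X + k, ?_, by rw [A.S.add_int, hk]⟩
      rw [(coe_eq_iff (X + k) X).2 ⟨k, rfl⟩, hX]; exact x.2
    have haK : (a : UnitAddCircle) ∈ D.K := by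
      by_contra hn
      obtain ⟨ε, hε, hb⟩ := Metric.isOpen_iff.1 hcl.isOpen_compl a hn
      have h1 : P (a - ε / 2) < t := by
        refine lt_of_le_of_ne (hPa ▸ A.S.mono (by linarith)) fun h => ?_
        have := ((hf _).1 h).1; linarith
      obtain ⟨x, hx, hPx⟩ := hsur ((P (a - ε / 2) + t) / 2)
      refine hb (a := x) ?_ hx
      have h2 : x < a := by
        by_contra hh; have := A.S.mono (not_lt.1 hh); linarith
      have h3 : a - ε / 2 < x := by
        by_contra hh; have := A.S.mono (not_lt.1 hh); linarith
      rw [Metric.mem_ball, Real.dist_eq, abs_lt]; constructor <;> linarith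
    have hbK : (b : UnitAddCircle) ∈ D.K := by
      by_contra hn
      obtain ⟨ε, hε, hb⟩ := Metric.isOpen_iff.1 hcl.isOpen_compl b hn
      have h1 : t < P (b + ε / 2) := by
        refine lt_of_le_of_ne (hPb ▸ A.S.mono (by linarith)) fun h => ?_
        have := ((hf _).1 h.symm).2; linarith
      obtain ⟨x, hx, hPx⟩ := hsur ((P (b + ε / 2) + t) / 2)
      refine hb (a := x) ?_ hx
      have h2 : b < x := by
        by_contra hh; have := A.S.mono (not_lt.1 hh); linarith
      have h3 : x < b + ε / 2 := by
        by_contra hh; have := A.S.mono (not_lt.1 hh); linarith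
      rw [Metric.mem_ball, Real.dist_eq, abs_lt]; constructor <;> linarith
    refine ⟨⟨a, haK⟩, ⟨b, hbK⟩, ?_, by rw [A.coe, hPa], by rw [A.coe, hPb]⟩
    intro h
    obtain ⟨k, hk⟩ := (coe_eq_iff _ _).1 (congrArg Subtype.val h)
    have h1 := A.S.add_int b k
    rw [← hk, hPa, hPb] at h1
    linarith
  · rintro ⟨x, y, hxy, hx, hy⟩
    have aux : ∀ x : D.K, p x = (t : UnitAddCircle) →
        ∃ X : ℝ, (X : UnitAddCircle) = x ∧ P X = t := by
      intro x hx
      obtain ⟨X, hX⟩ := exists_coe x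
      rw [← hX, A.coe] at hx
      obtain ⟨k, hk⟩ := (coe_eq_iff _ _).1 hx.symm
      exact ⟨X + k, by rw [(coe_eq_iff (X + k) X).2 ⟨k, rfl⟩, hX], by rw [A.S.add_int, hk]⟩
    obtain ⟨X, hX, hPX⟩ := aux x hx
    obtain ⟨Y, hY, hPY⟩ := aux y hy
    have hne : X ≠ Y := by
      rintro rfl
      exact hxy (Subtype.ext (hX.symm.trans hY))
    rcases hne.lt_or_gt with h | h
    · exact ⟨X, Y, h, hPX, hPY⟩
    · exact ⟨Y, X, h, hPY, hPX⟩

end Fac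

section Pair

variable {D₁ D₂ : DenjoySystem} {P₁ P₂ : ℝ → ℝ} {p₁ p₂ : UnitAddCircle → UnitAddCircle}

lemma prox_transfer (A₁ : Fac D₁ P₁ p₁) (A₂ : Fac D₂ P₂ p₂) (φ : D₁.K ≃ₜ D₂.K)
    (hφ : ∀ x, φ (D₁.hK x) = D₂.hK (φ x)) (x y : D₁.K) (h : p₁ x = p₁ y) :
    p₂ (φ x) = p₂ (φ y) := by
  have : CompactSpace D₁.K := isCompact_iff_compactSpace.1 D₁.K_cpt
  let ψ : D₁.K → UnitAddCircle := fun x => p₂ (φ x)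
  have hψc : Continuous ψ := A₂.cont.comp (continuous_subtype_val.comp φ.continuous)
  have hψ : ∀ x, ψ (D₁.hK x) = ψ x + (D₂.rot : UnitAddCircle) := fun x => by
    simp only [ψ, hφ]
    exact A₂.semi _
  have hψn : ∀ (n : ℕ) x, ψ (D₁.hK^[n] x) = ψ x + n • (D₂.rot : UnitAddCircle) := by
    intro n
    induction n with
    | zero => simp
    | succ n ih =>
      intro x
      rw [Function.iterate_succ_apply, ih, hψ, succ_nsmul]; abel
  by_contra hne
  have hpos : 0 < dist (ψ x) (ψ y) := dist_pos.2 hne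
  obtain ⟨δ, hδ, hu⟩ := Metric.uniformContinuous_iff.1
    (CompactSpace.uniformContinuous_of_continuous hψc) _ hpos
  obtain ⟨n, hn⟩ := A₁.prox h hδ
  have h1 := hu (a := D₁.hK^[n] x) (b := D₁.hK^[n] y) (by
    rw [Subtype.dist_eq, D₁.hK_iter, D₁.hK_iter]; exact hn)
  rw [hψn, hψn, dist_add_right] at h1
  exact lt_irrefl _ h1

lemma exists_factor (A₁ : Fac D₁ P₁ p₁) (A₂ : Fac D₂ P₂ p₂) (φ : D₁.K ≃ₜ D₂.K)
    (hφ : ∀ x, φ (D₁.hK x) = D₂.hK (φ x)) :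
    ∃ c : UnitAddCircle, (∀ x, p₂ (φ x) = p₁ x + c) ∨ (∀ x, p₂ (φ x) = -p₁ x + c) := by
  have : CompactSpace D₁.K := isCompact_iff_compactSpace.1 D₁.K_cpt
  have hφ' : ∀ x, φ.symm (D₂.hK x) = D₁.hK (φ.symm x) := fun x => by
    apply φ.injective; rw [hφ]; simp
  choose s hs using A₁.surjK
  let q : UnitAddCircle → UnitAddCircle := fun t => p₂ (φ (s t))
  have hq : ∀ x : D₁.K, q (p₁ x) = p₂ (φ x) := fun x =>
    prox_transfer A₁ A₂ φ hφ _ _ (hs _)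
  have hqinj : Function.Injective q := by
    intro a b hab
    have := prox_transfer A₂ A₁ φ.symm hφ' _ _ hab
    simpa [hs] using this
  have hp1 : Continuous (fun x : D₁.K => p₁ x) := A₁.cont.comp continuous_subtype_val
  have hquot : Topology.IsQuotientMap (fun x : D₁.K => p₁ x) :=
    hp1.isClosedMap.isQuotientMap hp1 A₁.surjK
  have hqc : Continuous q := by
    rw [hquot.continuous_iff]
    have : q ∘ (fun x : D₁.K => p₁ x) = fun x => p₂ (φ x) := funext hq
    rw [this]
    exact A₂.cont.comp (continuous_subtype_val.comp φ.continuous)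
  have hqρ : ∀ t, q (t + (D₁.rot : UnitAddCircle)) = q t + (D₂.rot : UnitAddCircle) := by
    intro t
    obtain ⟨x, rfl⟩ := A₁.surjK t
    have h1 := hq (D₁.hK x)
    rw [hφ] at h1
    change q (p₁ (D₁.h x)) = p₂ (D₂.h (φ x)) at h1
    rw [A₁.semi, A₂.semi] at h1
    rw [h1, hq]
  have hqn : ∀ (n : ℤ) t, q (t + n • (D₁.rot : UnitAddCircle))
      = q t + n • (D₂.rot : UnitAddCircle) := by
    intro n t
    induction n using Int.induction_on with
    | zero => simp
    | succ i ih =>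
      rw [add_zsmul, one_zsmul, ← add_assoc, hqρ, ih, add_zsmul, one_zsmul, add_assoc]
    | pred i ih =>
      have := hqρ (t + (-(i : ℤ) - 1) • (D₁.rot : UnitAddCircle))
      rw [sub_zsmul, one_zsmul, ← sub_eq_add_neg, ← add_sub_assoc, sub_add_cancel, ih] at this
      rw [sub_zsmul, one_zsmul, sub_zsmul, one_zsmul, ← sub_eq_add_neg, ← sub_eq_add_neg,
        ← add_sub_assoc, ← add_sub_assoc, this,
        add_sub_cancel_right]
  have hd : DenseRange (fun n : ℤ => n • (D₁.rot : UnitAddCircle)) :=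
    AddCircle.denseRange_zsmul_coe_iff.2 (by simpa using D₁.rot_irr)
  have hqadd : ∀ t u, q (t + u) = q t + q u - q 0 := by
    intro t u
    refine hd.induction_on (p := fun u => q (t + u) = q t + q u - q 0) u ?_ ?_
    · exact isClosed_eq (hqc.comp (continuous_const.add continuous_id))
        ((continuous_const.add hqc).sub continuous_const)
    · intro n
      have h0 := hqn n 0
      rw [zero_add] at h0
      rw [hqn, h0]; abel
  refine ⟨q 0, ?_⟩
  have := injective_hom_sign (fun t => q t - q 0) (hqc.sub continuous_const)
    (fun x y => by simp only [hqadd]; abel) (fun a b hab => hqinj (by simpa using hab))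
  rcases this with h | h
  · left; intro x
    rw [← hq]; exact sub_eq_iff_eq_add.1 (h (p₁ x))
  · right; intro x
    rw [← hq]; exact sub_eq_iff_eq_add.1 (h (p₁ x))

lemma conj_of_homeo (D₁ D₂ : DenjoySystem) (φ : D₁.K ≃ₜ D₂.K)
    (hφ : ∀ x, φ (D₁.hK x) = D₂.hK (φ x)) :
    ∃ g : UnitAddCircle ≃ₜ UnitAddCircle, ∀ x, g (D₁.h x) = D₂.h (g x) := by
  obtain ⟨P₁, p₁, A₁⟩ := exists_fac D₁
  obtain ⟨P₂, p₂, A₂⟩ := exists_fac D₂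
  obtain ⟨c, hc⟩ := exists_factor A₁ A₂ φ hφ
  obtain ⟨c, rfl⟩ := exists_coe c
  obtain ⟨x0, hx0⟩ := D₁.K_ne
  have hrot := A₂.semi (φ ⟨x0, hx0⟩)
  have hφ0 : D₂.h (φ ⟨x0, hx0⟩) = φ (D₁.hK ⟨x0, hx0⟩) := (congrArg Subtype.val (hφ ⟨x0, hx0⟩)).symm
  have hsem := A₁.semi x0
  rw [hφ0] at hrot
  rcases hc with hc | hc
  · rw [hc, hc] at hrot
    change p₁ (D₁.h x0) + _ = p₁ x0 + _ + _ at hrot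
    rw [hsem] at hrot
    have hr : (D₂.rot : UnitAddCircle) = (D₁.rot : UnitAddCircle) := by
      rw [add_assoc, add_assoc] at hrot
      have := add_left_cancel hrot
      rw [add_comm] at this
      exact (add_left_cancel this).symm
    obtain ⟨k, hk⟩ := (coe_eq_iff _ _).1 hr
    have S₂ : SemiLift (D₂.H.trans (OrderIso.addRight (-(k : ℝ)))) (fun x => P₂ x - c) D₁.rot := by
      refine ⟨A₂.S.cont.sub continuous_const, fun x y h => sub_le_sub_right (A₂.S.mono h) _,
        fun x => by rw [A₂.S.add_one]; ring, fun x => ?_⟩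
      have := A₂.S.add_int (D₂.H x) (-k)
      push_cast at this
      simp only [OrderIso.trans_apply, OrderIso.addRight_apply]
      rw [this, A₂.S.semi]; linarith
    obtain ⟨G, hG1, hG⟩ := exists_conj_lift D₁.rot_irr A₁.S S₂ D₁.H_add_one
      (fun x => by
        simp only [OrderIso.trans_apply, OrderIso.addRight_apply, D₂.H_add_one]; ring) (by
        intro t
        have h2 : NT (fun x => P₂ x - c) t ↔ NT P₂ (t + c) := by
          simp only [NT, sub_eq_iff_eq_add]
        rw [h2, A₁.NT_iff, A₂.NT_iff]
        constructor
        · rintro ⟨x, y, hxy, hx, hy⟩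
          exact ⟨φ x, φ y, fun h => hxy (φ.injective h), by rw [hc, hx]; rfl, by rw [hc, hy]; rfl⟩
        · rintro ⟨x, y, hxy, hx, hy⟩
          obtain ⟨x, rfl⟩ := φ.surjective x
          obtain ⟨y, rfl⟩ := φ.surjective y
          rw [hc, AddCircle.coe_add] at hx hy
          exact ⟨x, y, fun h => hxy (by rw [h]), add_right_cancel hx, add_right_cancel hy⟩)
    obtain ⟨g, hg⟩ := exists_circle_homeo G hG1
    refine ⟨g, fun x => ?_⟩
    obtain ⟨X, rfl⟩ := exists_coe x
    rw [← D₁.H_coe, hg, hg, hG, ← D₂.H_coe]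
    exact (coe_eq_iff _ _).2 ⟨-k, by simp⟩
  · rw [hc, hc] at hrot
    change -p₁ (D₁.h x0) + _ = -p₁ x0 + _ + _ at hrot
    rw [hsem] at hrot
    have hr : (D₂.rot : UnitAddCircle) = ((-D₁.rot : ℝ) : UnitAddCircle) := by
      rw [AddCircle.coe_neg]
      have h1 : (D₂.rot : UnitAddCircle) = (-p₁ x0 + c + D₂.rot) - (-p₁ x0 + c) := by abel
      rw [h1, ← hrot]; abel
    obtain ⟨k, hk⟩ := (coe_eq_iff _ _).1 hr
    let N : ℝ ≃o ℝ := StrictMono.orderIsoOfSurjective (fun x => -D₂.H (-x) + k)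
      (fun x y h => by
        have := D₂.H.strictMono (neg_lt_neg h)
        simp only; linarith)
      (fun y => ⟨-D₂.H.symm (-(y - k)), by simp⟩)
    have hN : ∀ x, N x = -D₂.H (-x) + k := fun x => rfl
    have S₂ : SemiLift N (fun x => c - P₂ (-x)) D₁.rot := by
      refine ⟨continuous_const.sub (A₂.S.cont.comp continuous_neg),
        fun x y h => sub_le_sub_left (A₂.S.mono (neg_le_neg h)) _,
        fun x => ?_, fun x => ?_⟩
      · have := A₂.S.add_one (-(x + 1))
        rw [show -(x + 1) + 1 = -x by ring] at this
        linarith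
      · have := A₂.S.add_int (D₂.H (-x)) (-k)
        push_cast at this
        rw [hN, show -(-D₂.H (-x) + (k : ℝ)) = D₂.H (-x) + -k by ring, this, A₂.S.semi]; linarith
    obtain ⟨G, hG1, hG⟩ := exists_conj_lift D₁.rot_irr A₁.S S₂ D₁.H_add_one
      (fun x => by
        have := D₂.H_add_one (-(x + 1))
        rw [show -(x + 1) + 1 = -x by ring] at this
        rw [hN, hN]; linarith) (by
        intro t
        have h2 : NT (fun x => c - P₂ (-x)) t ↔ NT P₂ (-t + c) := by
          constructor
          · rintro ⟨x, y, hxy, hx, hy⟩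
            exact ⟨-y, -x, by linarith, by linarith, by linarith⟩
          · rintro ⟨x, y, hxy, hx, hy⟩
            exact ⟨-y, -x, by linarith, by simp only [neg_neg]; linarith,
              by simp only [neg_neg]; linarith⟩
        rw [h2, A₁.NT_iff, A₂.NT_iff]
        constructor
        · rintro ⟨x, y, hxy, hx, hy⟩
          exact ⟨φ x, φ y, fun h => hxy (φ.injective h), by rw [hc, hx]; rfl, by rw [hc, hy]; rfl⟩
        · rintro ⟨x, y, hxy, hx, hy⟩
          obtain ⟨x, rfl⟩ := φ.surjective x
          obtain ⟨y, rfl⟩ := φ.surjective y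
          rw [hc, AddCircle.coe_add, AddCircle.coe_neg] at hx hy
          exact ⟨x, y, fun h => hxy (by rw [h]), neg_injective (add_right_cancel hx),
            neg_injective (add_right_cancel hy)⟩)
    obtain ⟨g, hg⟩ := exists_circle_homeo G hG1
    refine ⟨g.trans (Homeomorph.neg _), fun x => ?_⟩
    obtain ⟨X, rfl⟩ := exists_coe x
    simp only [Homeomorph.trans_apply, Homeomorph.coe_neg]
    rw [← D₁.H_coe, hg, hg, hG, ← AddCircle.coe_neg, ← AddCircle.coe_neg, ← D₂.H_coe, hN]
    exact (coe_eq_iff _ _).2 ⟨-k, by push_cast; ring⟩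

end Pair

/-- Two equivalent weak Denjoy sub-systems for a same homeomorphism have conjugate
Denjoy examples. -/
theorem equivalent_WDS_conjugate
    {M : Type*} [MetricSpace M] (f : M → M) (hf : IsHomeomorph f)
    (W₁ W₂ : WDS M f) (hrange : Set.range W₁.j = Set.range W₂.j) :
    ∃ g : UnitAddCircle ≃ₜ UnitAddCircle, ∀ x : UnitAddCircle, g (W₁.h x) = W₂.h (g x) := by
  let φ : W₁.K ≃ₜ W₂.K := (W₁.j_emb.toHomeomorph.trans (Homeomorph.setCongr hrange)).trans
    W₂.j_emb.toHomeomorph.symm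
  have hφ : ∀ x, W₂.j (φ x) = W₁.j x := fun x =>
    congrArg Subtype.val (W₂.j_emb.toHomeomorph.apply_symm_apply
      (Homeomorph.setCongr hrange (W₁.j_emb.toHomeomorph x)))
  refine conj_of_homeo W₁.toDenjoySystem W₂.toDenjoySystem φ fun x => ?_
  apply W₂.j_emb.injective
  rw [hφ, W₁.equivar x (W₁.hK x) rfl, W₂.equivar (φ x) (W₂.hK (φ x)) rfl, hφ]
end
end

section
/- Let M be a metric space and f : M → M a homeomorphism. Let (K₁, j₁, h₁) and (K₂, j₂, h₂) be two weak Denjoy sub-systems for f with j₁(K₁) = j₂(K₂). Then the rotation numbers satisfy ρ(h₁) = ρ(h₂) or ρ(h₁) = −ρ(h₂) in 𝕋 = ℝ/ℤ. -/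
open Filter Topology Set

noncomputable section

theorem real_const_of_coe_const (u : ℝ → ℝ) (hu : Continuous u) (c : UnitAddCircle)
    (h : ∀ x, (u x : UnitAddCircle) = c) (x : ℝ) : u x = u 0 := by
  have hcov : IsCoveringMap ((↑) : ℝ → UnitAddCircle) := AddCircle.isCoveringMap_coe (1 : ℝ)
  have := hcov.eq_of_comp_eq (g₁ := u) (g₂ := fun _ => u 0) hu continuous_const
    (by funext y; simp [h]) 0 rfl
  exact congrFun this x

theorem exists_real_lift (G : ℝ → UnitAddCircle) (hG : Continuous G) :
    ∃ u : ℝ → ℝ, Continuous u ∧ ∀ x, (u x : UnitAddCircle) = G x := by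
  have hcov : IsCoveringMap ((↑) : ℝ → UnitAddCircle) := AddCircle.isCoveringMap_coe (1 : ℝ)
  obtain ⟨e, he⟩ := QuotientAddGroup.mk_surjective (G 0)
  obtain ⟨F, ⟨_, hF⟩, _⟩ := hcov.existsUnique_continuousMap_lifts ⟨G, hG⟩ 0 e he
  exact ⟨F, F.continuous, fun x => congrFun hF x⟩

theorem coe_eq_zero_iff' (x : ℝ) : (x : UnitAddCircle) = 0 ↔ ∃ n : ℤ, (n : ℝ) = x := by
  rw [AddCircle.coe_eq_zero_iff]
  simp

theorem coe_int_zero (n : ℤ) : ((n : ℝ) : UnitAddCircle) = 0 :=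
  (coe_eq_zero_iff' _).2 ⟨n, rfl⟩

theorem coe_one_zero : ((1 : ℝ) : UnitAddCircle) = 0 := by
  have := coe_int_zero 1
  rwa [Int.cast_one] at this

namespace DenjoySystem

variable (D : DenjoySystem)

/-- The lift as a bundled degree one map. -/
def deg1 : CircleDeg1Lift := ⟨⟨D.lift, D.lift_mono.monotone⟩, D.lift_add⟩

theorem deg1_apply (x : ℝ) : D.deg1 x = D.lift x := rfl

theorem transNum : CircleDeg1Lift.translationNumber D.deg1 = D.rot := by
  apply CircleDeg1Lift.translationNumber_eq_of_tendsto₀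
  exact D.rot_lim

theorem exists_semiconj : ∃ F : ℝ → ℝ, Continuous F ∧ (∀ x, F (x + 1) = F x + 1) ∧
    ∀ x, F (D.lift x) = F x + D.rot := by
  obtain ⟨F, hF⟩ := CircleDeg1Lift.semiconj_of_isUnit_of_translationNumber_eq
    (f₁ := D.deg1) (f₂ := (CircleDeg1Lift.translate (Multiplicative.ofAdd D.rot) : CircleDeg1Lift))
    (CircleDeg1Lift.isUnit_iff_bijective.2 D.lift_bij) (Units.isUnit _)
    (by rw [D.transNum, CircleDeg1Lift.translationNumber_translate])
  have hF' : ∀ x, F (D.lift x) = F x + D.rot := by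
    intro x
    have := hF x
    rw [CircleDeg1Lift.translate_apply, deg1_apply] at this
    rw [this, add_comm]
  refine ⟨F, ?_, F.map_add_one, hF'⟩
  apply F.monotone.continuous_of_denseRange
  have hd : Dense (AddSubgroup.closure {D.rot, 1} : Set ℝ) := by
    rw [dense_addSubgroupClosure_pair_iff]
    simpa using D.rot_irr
  have hsub : (AddSubgroup.closure {D.rot, 1} : Set ℝ) ⊆ (fun y => y - F 0) '' range F := by
    let S : AddSubgroup ℝ :=
      { carrier := {s | ∀ y ∈ range F, y + s ∈ range F ∧ y - s ∈ range F}
        zero_mem' := by intro y hy; simpa using hy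
        add_mem' := by
          intro a b ha hb y hy
          refine ⟨?_, ?_⟩
          · rw [← add_assoc]; exact (hb _ (ha _ hy).1).1
          · rw [← sub_sub]; exact (hb _ (ha _ hy).2).2
        neg_mem' := by
          intro a ha y hy
          refine ⟨?_, ?_⟩
          · rw [← sub_eq_add_neg]; exact (ha _ hy).2
          · rw [sub_neg_eq_add]; exact (ha _ hy).1 }
    have hS : AddSubgroup.closure {D.rot, 1} ≤ S := by
      rw [AddSubgroup.closure_le]
      rintro s (rfl | rfl)
      · rintro _ ⟨x, rfl⟩
        refine ⟨⟨D.lift x, hF' x⟩, ?_⟩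
        obtain ⟨z, rfl⟩ := D.lift_bij.2 x
        exact ⟨z, by rw [hF']; ring⟩
      · rintro _ ⟨x, rfl⟩
        refine ⟨⟨x + 1, F.map_add_one x⟩, ⟨x - 1, ?_⟩⟩
        have := F.map_add_one (x - 1)
        rw [sub_add_cancel] at this
        linarith
    intro s hs
    exact ⟨F 0 + s, (hS hs (F 0) ⟨0, rfl⟩).1, by ring⟩
  have h2 := hd.mono hsub
  have h3 := (Homeomorph.addRight (F 0)).surjective.denseRange.dense_image
    (Homeomorph.addRight (F 0)).continuous h2
  rw [image_image] at h3
  simpa [DenseRange] using h3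

theorem exists_eigen : ∃ p : UnitAddCircle → UnitAddCircle, Continuous p ∧
    ∀ x, p (D.h x) = p x + (D.rot : UnitAddCircle) := by
  obtain ⟨F, hc, h1, hF⟩ := D.exists_semiconj
  have hper : Function.Periodic (fun x => (F x : UnitAddCircle)) 1 := by
    intro x
    simp only [h1, AddCircle.coe_add, coe_one_zero, add_zero]
  refine ⟨hper.lift, ?_, ?_⟩
  · refine continuous_coinduced_dom.2 ?_
    exact (AddCircle.continuous_mk' 1).comp hc
  · intro x
    obtain ⟨x, rfl⟩ := QuotientAddGroup.mk_surjective x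
    have := D.lift_proj x
    change hper.lift (D.h (x : UnitAddCircle)) = hper.lift (x : UnitAddCircle) + _
    rw [← this, hper.lift_coe, hper.lift_coe, hF, AddCircle.coe_add]

/-- preimage of K in the line -/
def C : Set ℝ := {x | (x : UnitAddCircle) ∈ D.K}

theorem C_closed : IsClosed D.C :=
  D.K_cpt.isClosed.preimage (AddCircle.continuous_mk' 1)

theorem C_add_int (x : ℝ) (n : ℤ) : x + n ∈ D.C ↔ x ∈ D.C := by
  simp only [C, mem_ofPred_eq, AddCircle.coe_add, coe_int_zero, add_zero]

theorem C_lift (x : ℝ) : D.lift x ∈ D.C ↔ x ∈ D.C := by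
  simp only [C, mem_ofPred_eq, D.lift_proj]
  constructor
  · intro h
    rw [← D.K_inv] at h
    obtain ⟨y, hy, e⟩ := h
    rwa [← D.h.injective e]
  · intro h
    rw [← D.K_inv]
    exact ⟨_, h, rfl⟩

theorem C_iter (x : ℝ) (n : ℕ) : D.lift^[n] x ∈ D.C ↔ x ∈ D.C := by
  induction n with
  | zero => rfl
  | succ n ih => rw [Function.iterate_succ_apply', C_lift, ih]

theorem C_ne : ∃ x, x ∈ D.C := by
  obtain ⟨y, hy⟩ := D.K_ne
  obtain ⟨x, rfl⟩ := QuotientAddGroup.mk_surjective y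
  exact ⟨x, hy⟩

theorem exists_a (x : ℝ) : ∃ a, IsGreatest (D.C ∩ Iic x) a := by
  obtain ⟨c, hc⟩ := D.C_ne
  have hne : (D.C ∩ Iic x).Nonempty := by
    refine ⟨c + (⌊x - c⌋ : ℤ), (D.C_add_int _ _).2 hc, ?_⟩
    have := Int.floor_le (x - c)
    simp only [mem_Iic]; linarith
  have hb : BddAbove (D.C ∩ Iic x) := ⟨x, fun y hy => hy.2⟩
  exact ⟨_, (D.C_closed.inter isClosed_Iic).csSup_mem hne hb, fun y hy => le_csSup hb hy⟩

theorem exists_b (x : ℝ) : ∃ b, IsLeast (D.C ∩ Ici x) b := by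
  obtain ⟨c, hc⟩ := D.C_ne
  have hne : (D.C ∩ Ici x).Nonempty := by
    refine ⟨c + (⌈x - c⌉ : ℤ), (D.C_add_int _ _).2 hc, ?_⟩
    have := Int.le_ceil (x - c)
    simp only [mem_Ici]; linarith
  have hb : BddBelow (D.C ∩ Ici x) := ⟨x, fun y hy => hy.2⟩
  exact ⟨_, (D.C_closed.inter isClosed_Ici).csInf_mem hne hb, fun y hy => csInf_le hb hy⟩

theorem no_periodic (x : ℝ) (n : ℕ) (hn : 0 < n) (m : ℤ) : D.lift^[n] x ≠ x + m := by
  intro h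
  have h1 := D.deg1.translationNumber_of_map_pow_eq_add_int (x := x) (n := n) (m := m)
    (by rw [CircleDeg1Lift.coe_pow]; exact h) hn
  rw [transNum] at h1
  apply D.rot_irr
  exact ⟨(m : ℚ) / n, by rw [h1]; push_cast; rfl⟩

theorem iter_mono (n : ℕ) : StrictMono (D.lift^[n]) := D.lift_mono.iterate n

theorem iter_add_int (x : ℝ) (n : ℕ) (m : ℤ) : D.lift^[n] (x + m) = D.lift^[n] x + m := by
  have := (D.deg1 ^ n).map_add_int x m
  rw [CircleDeg1Lift.coe_pow] at this
  exact this

theorem exists_close (a ε : ℝ) (hε : 0 < ε) : ∃ n m : ℕ, n < m ∧ ∃ p : ℤ,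
    |D.lift^[n] a + p - D.lift^[m] a| < ε := by
  have hK : IsCompact (Icc (0 : ℝ) 1) := isCompact_Icc
  obtain ⟨l, -, φ, hφ, hl⟩ := hK.tendsto_subseq (x := fun n => Int.fract (D.lift^[n] a))
    (fun n => ⟨Int.fract_nonneg _, (Int.fract_lt_one _).le⟩)
  obtain ⟨N, hN⟩ := Metric.cauchySeq_iff.1 hl.cauchySeq ε hε
  have := hN N le_rfl (N + 1) (Nat.le_succ N)
  refine ⟨φ N, φ (N + 1), hφ (Nat.lt_succ_self N),
    ⌊D.lift^[φ (N + 1)] a⌋ - ⌊D.lift^[φ N] a⌋, ?_⟩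
  rw [Real.dist_eq] at this
  convert this using 2
  simp only [Function.comp, Int.fract]
  push_cast
  ring

theorem gap_shrinks (a b : ℝ) (ha : a ∈ D.C) (hab : a < b)
    (hgap : ∀ x ∈ Ioo a b, x ∉ D.C) (ε : ℝ) (hε : 0 < ε) :
    ∃ n, D.lift^[n] b - D.lift^[n] a < ε := by
  by_contra! hcon
  obtain ⟨n, m, hnm, p, hp⟩ := D.exists_close a ε hε
  have hgapn : ∀ n (x : ℝ), D.lift^[n] a < x → x < D.lift^[n] b → x ∉ D.C := by
    intro n x h1 h2 hx
    obtain ⟨y, rfl⟩ := (D.lift_bij.iterate n).2 x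
    rw [(D.iter_mono n).lt_iff_lt] at h1 h2
    exact hgap y ⟨h1, h2⟩ ((D.C_iter y n).1 hx)
  rw [abs_lt] at hp
  rcases lt_trichotomy (D.lift^[n] a + p) (D.lift^[m] a) with h | h | h
  · have := hgapn n (D.lift^[m] a + ((-p : ℤ) : ℝ)) (by push_cast; linarith)
      (by push_cast; linarith [hcon n])
    exact this ((D.C_add_int _ _).2 ((D.C_iter a m).2 ha))
  · obtain ⟨k, rfl⟩ := Nat.exists_eq_add_of_lt hnm
    have h2 : D.lift^[n + k + 1] a = D.lift^[k + 1] (D.lift^[n] a) := by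
      rw [← Function.iterate_add_apply, show n + k + 1 = k + 1 + n by omega]
    exact D.no_periodic (D.lift^[n] a) (k + 1) (Nat.succ_pos k) p (by rw [← h2, h])
  · have := hgapn m (D.lift^[n] a + p) h (by linarith [hcon m])
    exact this ((D.C_add_int _ _).2 ((D.C_iter a n).2 ha))

theorem dist_coe_le (x y : ℝ) : dist (x : UnitAddCircle) (y : UnitAddCircle) ≤ |x - y| := by
  rw [dist_eq_norm, ← AddCircle.coe_sub, UnitAddCircle.norm_eq]
  exact round_le (x - y) 0 |>.trans (by simp)

variable (γ : UnitAddCircle → UnitAddCircle) (β : UnitAddCircle)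

theorem eigen_gap (hγ : ContinuousOn γ D.K) (heq : ∀ x ∈ D.K, γ (D.h x) = γ x + β)
    (a b : ℝ) (ha : a ∈ D.C) (hb : b ∈ D.C) (hab : a < b)
    (hgap : ∀ x ∈ Ioo a b, x ∉ D.C) : γ a = γ b := by
  have hu := D.K_cpt.uniformContinuousOn_of_continuous hγ
  rw [Metric.uniformContinuousOn_iff] at hu
  have hit : ∀ (n : ℕ) (x : ℝ), x ∈ D.C → γ (D.lift^[n] x : ℝ) = γ x + n • β := by
    intro n x hx
    induction n with
    | zero => simp
    | succ n ih =>
      rw [Function.iterate_succ_apply', D.lift_proj, heq _ ((D.C_iter x n).2 hx), ih, succ_nsmul,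
        add_assoc]
  refine eq_of_forall_dist_le fun ε hε => ?_
  obtain ⟨δ, hδ, hu⟩ := hu ε hε
  obtain ⟨n, hn⟩ := D.gap_shrinks a b ha hab hgap δ hδ
  have h1 := hu _ ((D.C_iter a n).2 ha) _ ((D.C_iter b n).2 hb)
    (lt_of_le_of_lt (dist_coe_le _ _) (by
      rw [abs_sub_comm, abs_of_pos]
      · exact hn
      · have := D.iter_mono n hab
        linarith))
  rw [hit n a ha, hit n b hb, dist_add_right] at h1
  exact h1.le

theorem exists_ext (hγ : ContinuousOn γ D.K) (heq : ∀ x ∈ D.K, γ (D.h x) = γ x + β) :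
    ∃ G : ℝ → UnitAddCircle, Continuous G ∧ (∀ x, G (x + 1) = G x) ∧
      ∀ x, G (D.lift x) = G x + β := by
  choose a ha using D.exists_a
  choose b hb using D.exists_b
  have hu := D.K_cpt.uniformContinuousOn_of_continuous hγ
  rw [Metric.uniformContinuousOn_iff] at hu
  have hab : ∀ x, γ (a x) = γ (b x) := by
    intro x
    have h1 : a x ≤ x := (ha x).1.2
    have h2 : x ≤ b x := (hb x).1.2
    rcases (h1.trans h2).eq_or_lt with h | h
    · rw [h]
    · refine D.eigen_gap γ β hγ heq _ _ (ha x).1.1 (hb x).1.1 h ?_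
      intro y hy hyC
      rcases le_total y x with hyx | hyx
      · exact absurd ((ha x).2 ⟨hyC, hyx⟩) (not_le.2 hy.1)
      · exact absurd ((hb x).2 ⟨hyC, hyx⟩) (not_le.2 hy.2)
  refine ⟨fun x => γ (a x), ?_, ?_, ?_⟩
  · rw [continuous_iff_continuousAt]
    intro x
    by_cases hx : x ∈ D.C
    · have hax : a x = x := (ha x).unique ⟨⟨hx, le_refl x⟩, fun y hy => hy.2⟩
      rw [Metric.continuousAt_iff]
      intro ε hε
      obtain ⟨δ, hδ, hu⟩ := hu ε hε
      refine ⟨δ, hδ, ?_⟩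
      intro y hy
      rw [Real.dist_eq, abs_lt] at hy
      simp only [hax]
      rcases le_total x y with hxy | hxy
      · refine hu _ (ha y).1.1 _ hx (lt_of_le_of_lt (dist_coe_le _ _) ?_)
        have h1 : a y ≤ y := (ha y).1.2
        have h2 : x ≤ a y := (ha y).2 ⟨hx, hxy⟩
        rw [abs_lt]; constructor <;> linarith
      · rw [hab y]
        refine hu _ (hb y).1.1 _ hx (lt_of_le_of_lt (dist_coe_le _ _) ?_)
        have h1 : y ≤ b y := (hb y).1.2
        have h2 : b y ≤ x := (hb y).2 ⟨hx, hxy⟩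
        rw [abs_lt]; constructor <;> linarith
    · have h1 : a x < x := lt_of_le_of_ne (ha x).1.2 (fun h => hx (h ▸ (ha x).1.1))
      have h2 : x < b x := lt_of_le_of_ne (hb x).1.2 (fun h => hx (h ▸ (hb x).1.1))
      have hev : (fun y => γ (a y)) =ᶠ[𝓝 x] fun _ => γ (a x) := by
        filter_upwards [Ioo_mem_nhds h1 h2] with y hy
        have : a y = a x := by
          refine (ha y).unique ⟨⟨(ha x).1.1, hy.1.le⟩, ?_⟩
          intro z hz
          rcases le_total z x with hzx | hzx
          · exact (ha x).2 ⟨hz.1, hzx⟩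
          · have h3 := (hb x).2 ⟨hz.1, hzx⟩
            have h4 : z ≤ y := hz.2
            linarith [hy.2]
        rw [this]
      exact continuousAt_const.congr hev.symm
  · intro x
    have : a (x + 1) = a x + 1 := by
      refine (ha (x + 1)).unique ⟨⟨by simpa using (D.C_add_int (a x) 1).2 (ha x).1.1, ?_⟩, ?_⟩
      · have : a x ≤ x := (ha x).1.2
        simp only [mem_Iic]; linarith
      · intro y hy
        have hy2 : y ≤ x + 1 := hy.2
        have := (ha x).2 (show y + ((-1 : ℤ) : ℝ) ∈ D.C ∩ Iic x from ⟨(D.C_add_int y (-1)).2 hy.1, by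
          simp only [mem_Iic]; push_cast; linarith⟩)
        push_cast at this
        linarith
    simp only [this, AddCircle.coe_add, coe_one_zero, add_zero]
  · intro x
    have : a (D.lift x) = D.lift (a x) := by
      refine (ha (D.lift x)).unique ⟨⟨(D.C_lift _).2 (ha x).1.1,
        D.lift_mono.monotone (ha x).1.2⟩, ?_⟩
      intro y hy
      obtain ⟨z, rfl⟩ := D.lift_bij.2 y
      exact D.lift_mono.monotone ((ha x).2 ⟨(D.C_lift z).1 hy.1, D.lift_mono.le_iff_le.1 hy.2⟩)
    simp only [this, D.lift_proj]
    exact heq _ (ha x).1.1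

theorem eigen_mem (hγ : ContinuousOn γ D.K) (heq : ∀ x ∈ D.K, γ (D.h x) = γ x + β) :
    ∃ k : ℤ, β = ((k * D.rot : ℝ) : UnitAddCircle) := by
  obtain ⟨G, hGc, hG1, hGl⟩ := D.exists_ext γ β hγ heq
  obtain ⟨u, huc, hu⟩ := exists_real_lift G hGc
  have hk := real_const_of_coe_const (fun x => u (x + 1) - u x) (by fun_prop) 0
    (by intro x; rw [AddCircle.coe_sub, hu, hu, hG1, sub_self])
  have hlc := D.lift_cont
  have hl := real_const_of_coe_const (fun x => u (D.lift x) - u x) (by fun_prop) β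
    (by intro x; rw [AddCircle.coe_sub, hu, hu, hGl, add_sub_cancel_left])
  obtain ⟨k, hk0⟩ := (coe_eq_zero_iff' (u (0 + 1) - u 0)).1
    (by rw [AddCircle.coe_sub, hu, hu, hG1, sub_self])
  set B := u (D.lift 0) - u 0 with hB
  have hBβ : (B : UnitAddCircle) = β := by
    rw [hB, AddCircle.coe_sub, hu, hu, hGl, add_sub_cancel_left]
  have hper : Function.Periodic (fun x => u x - k * x) 1 := by
    intro x
    have := hk x
    beta_reduce at this ⊢
    rw [← hk0] at this
    linarith
  obtain ⟨R, hR⟩ := (hper.isBounded_of_continuous one_ne_zero (by fun_prop)).exists_norm_le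
  have hiter : ∀ n : ℕ, u (D.lift^[n] 0) = u 0 + n * B := by
    intro n
    induction n with
    | zero => simp
    | succ n ih =>
      rw [Function.iterate_succ_apply']
      have := hl (D.lift^[n] 0)
      push_cast
      linarith
  refine ⟨k, ?_⟩
  have hlim1 : Tendsto (fun n : ℕ => k * (D.lift^[n] 0 / (n : ℝ))) atTop (𝓝 (k * D.rot)) :=
    D.rot_lim.const_mul _
  have hlim2 : Tendsto (fun n : ℕ => k * (D.lift^[n] 0 / (n : ℝ))) atTop (𝓝 B) := by
    rw [tendsto_iff_dist_tendsto_zero]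
    refine squeeze_zero' (Eventually.of_forall fun n => dist_nonneg) ?_
      (tendsto_const_div_atTop_nhds_zero_nat (R + |u 0|))
    filter_upwards [eventually_gt_atTop 0] with n hn
    have hn' : (0 : ℝ) < n := by exact_mod_cast hn
    have h1 := hR _ ⟨D.lift^[n] 0, rfl⟩
    simp only [Real.norm_eq_abs, hiter] at h1
    have h2 : k * (D.lift^[n] 0 / (n : ℝ)) - B
        = -((u 0 + n * B - k * D.lift^[n] 0) - u 0) / n := by
      field_simp
      ring
    rw [Real.dist_eq, h2, abs_div, abs_neg, abs_of_pos hn']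
    gcongr
    exact (abs_sub _ _).trans (by linarith)
  rw [← hBβ, tendsto_nhds_unique hlim1 hlim2]

end DenjoySystem

theorem WDS.exists_mul {M : Type*} [MetricSpace M] (f : M → M)
    (W₁ W₂ : WDS M f) (hrange : Set.range W₁.j = Set.range W₂.j) :
    ∃ k : ℤ, (W₁.rot : UnitAddCircle) = ((k * W₂.rot : ℝ) : UnitAddCircle) := by
  classical
  obtain ⟨p, hp, hpe⟩ := W₁.toDenjoySystem.exists_eigen
  have hex : ∀ x : W₂.K, ∃ y : W₁.K, W₁.j y = W₂.j x := by
    intro x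
    have : W₂.j x ∈ range W₁.j := hrange ▸ mem_range_self x
    exact this
  choose φ hφ using hex
  have hφc : Continuous φ := by
    rw [W₁.j_emb.continuous_iff]
    have : W₁.j ∘ φ = W₂.j := funext hφ
    rw [this]
    exact W₂.j_emb.continuous
  let γ : UnitAddCircle → UnitAddCircle := fun x => if h : x ∈ W₂.K then p (φ ⟨x, h⟩) else 0
  have hγ : ∀ x : W₂.K, γ x = p (φ x) := by
    intro x
    simp [γ]
  apply W₂.toDenjoySystem.eigen_mem γ
  · rw [continuousOn_iff_continuous_domRestrict]
    have : W₂.K.domRestrict γ = fun x => p (φ x) := funext hγ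
    rw [this]
    fun_prop
  · intro x hx
    have hhx : W₂.h x ∈ W₂.K := by
      rw [← W₂.K_inv]; exact ⟨x, hx, rfl⟩
    have hy : W₁.h (φ ⟨x, hx⟩) ∈ W₁.K := by
      have := mem_image_of_mem W₁.h (φ ⟨x, hx⟩).2
      exact W₁.K_inv.subset this
    have e1 := hγ ⟨x, hx⟩
    have e2 := hγ ⟨_, hhx⟩
    simp only at e1 e2
    rw [e1, e2, ← hpe]
    have e3 : φ ⟨W₂.h x, hhx⟩ = ⟨_, hy⟩ := by
      apply W₁.j_emb.injective
      rw [hφ, W₂.equivar ⟨x, hx⟩ ⟨_, hhx⟩ rfl, W₁.equivar (φ ⟨x, hx⟩) ⟨_, hy⟩ rfl, hφ]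
    rw [e3]

/-- Two equivalent weak Denjoy sub-systems for a same homeomorphism have the same
rotation number up to sign, as an element of the circle `ℝ/ℤ`. -/
theorem equivalent_WDS_rotation_number
    {M : Type*} [MetricSpace M] (f : M → M) (hf : IsHomeomorph f)
    (W₁ W₂ : WDS M f) (hrange : Set.range W₁.j = Set.range W₂.j) :
    (W₁.rot : UnitAddCircle) = (W₂.rot : UnitAddCircle) ∨
      (W₁.rot : UnitAddCircle) = -(W₂.rot : UnitAddCircle) := by
  obtain ⟨k, hk⟩ := WDS.exists_mul f W₁ W₂ hrange
  obtain ⟨l, hl⟩ := WDS.exists_mul f W₂ W₁ hrange.symm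
  have hk' := hk
  rw [← sub_eq_zero, ← AddCircle.coe_sub, coe_eq_zero_iff'] at hk' hl
  obtain ⟨p, hp⟩ := hk'
  obtain ⟨q, hq⟩ := hl
  have hkl : k * l = 1 := by
    by_contra hne
    have hne' : (1 - k * l : ℝ) ≠ 0 := by
      intro h
      apply hne
      have : (k * l : ℝ) = 1 := by linarith
      exact_mod_cast this
    apply W₁.rot_irr
    refine ⟨((k * q + p : ℤ) : ℚ) / ((1 - k * l : ℤ) : ℚ), ?_⟩
    push_cast
    rw [div_eq_iff hne', hp, hq]
    ring
  rcases Int.eq_one_or_neg_one_of_mul_eq_one hkl with rfl | rfl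
  · left; simpa using hk
  · right; simpa using hk
end
end
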